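/- Let F be a field, D a subring of F, and Z a nonempty subset of Zar_F(D). Then A(Z) is a local ring if and only if A(X(Z)) is a local ring for every projective model X of F/D. -/

import Mathlib

/-!
Common definitions: valuation rings of a field, the Zariski--Riemann space
`Zar_F(D)` with its Zariski and patch topologies, domination of local subrings,
residual algebraicity, integral closedness, and projective models of `F/D`.
-/

variable {F : Type*} [Field F]

/-- `x` lies in the maximal ideal (set of nonunits) of the (local) subring `R` of `F`. -/
def MemMaxIdeal (R : Subring F) (x : F) : Prop :=
  ∃ h : x ∈ R, ¬ IsUnit (⟨x, h⟩ : R)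

/-- The local ring `R` dominates the local ring `S` (both subrings of `F`):
`S ⊆ R` and the maximal ideal of `R` contracts to the maximal ideal of `S`. -/
def Dominates (R S : Subring F) : Prop :=
  S ≤ R ∧ ∀ x ∈ S, (MemMaxIdeal S x ↔ MemMaxIdeal R x)

/-- `V` is a valuation ring of the field `F`: for every nonzero `x ∈ F`,
`x ∈ V` or `x⁻¹ ∈ V`. -/
def IsValSubring (V : Subring F) : Prop :=
  ∀ x : F, x ≠ 0 → x ∈ V ∨ x⁻¹ ∈ V

/-- `Zar_F(D)`: the valuation rings of `F` containing `D`. -/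
def zarSet (D : Subring F) : Set (Subring F) :=
  {V | IsValSubring V ∧ D ≤ V}

/-- `Dom_F(D)`: the valuation rings of `F` dominating the local subring `D`. -/
def domSet (D : Subring F) : Set (Subring F) :=
  {V | IsValSubring V ∧ Dominates V D}

/-- The Zariski topology on a collection `X` of subrings of `F`, with basic open sets
`U(x₁,…,xₙ) = {R ∈ X : x₁,…,xₙ ∈ R}`. -/
def zariskiTop (X : Set (Subring F)) : TopologicalSpace X :=
  TopologicalSpace.generateFrom
    {U | ∃ s : Finset F, U = {R : X | ∀ x ∈ s, x ∈ (R : Subring F)}}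

/-- The patch topology on a collection `X` of subrings of `F`: generated by the
quasicompact Zariski-open sets together with their complements. -/
def patchTop (X : Set (Subring F)) : TopologicalSpace X :=
  TopologicalSpace.generateFrom
    ({U | @IsOpen _ (zariskiTop X) U ∧ @IsCompact _ (zariskiTop X) U} ∪
      {V | ∃ U, @IsOpen _ (zariskiTop X) U ∧ @IsCompact _ (zariskiTop X) U ∧ V = Uᶜ})

/-- `R` is residually algebraic over `D`: the residue field extension
`D/m_D → R/m_R` is algebraic, i.e. each element of `R` satisfies, modulo the
maximal ideal of `R`, a monic polynomial with coefficients in `D`. -/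
def ResiduallyAlgebraic (D R : Subring F) : Prop :=
  ∀ x ∈ R, ∃ p : Polynomial F, p.Monic ∧ (∀ i, p.coeff i ∈ D) ∧ MemMaxIdeal R (p.eval x)

/-- `R` is integrally closed in `F`: every element of `F` integral over `R` lies in `R`. -/
def IntegrallyClosedIn (R : Subring F) : Prop :=
  ∀ x : F, (∃ p : Polynomial F, p.Monic ∧ (∀ i, p.coeff i ∈ R) ∧ p.eval x = 0) → x ∈ R

/-- The localization of the subring `A` of `F` at the prime ideal `P`, viewed as the
subring of `F` generated by the fractions `a/b` with `a, b ∈ A`, `b ∉ P`. -/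
def localizationSubring (A : Subring F) (P : Ideal A) : Subring F :=
  Subring.closure {z : F | ∃ a b : A, b ∉ P ∧ z = (a : F) * (b : F)⁻¹}

/-- The ring `D[x₁/xᵢ, …, xₙ/xᵢ]`. -/
def modelChart (D : Subring F) {n : ℕ} (x : Fin n → F) (i : Fin n) : Subring F :=
  Subring.closure ((D : Set F) ∪ {y | ∃ j, y = x j * (x i)⁻¹})

/-- `X` is the projective model of `F/D` defined by some nonzero elements
`x₀, …, xₙ` of `F`: the set of all localizations of the rings
`D[x₀/xᵢ, …, xₙ/xᵢ]` at their prime ideals. -/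
def IsProjModel (D : Subring F) (X : Set (Subring F)) : Prop :=
  ∃ (n : ℕ) (x : Fin (n + 1) → F), (∀ i, x i ≠ 0) ∧
    X = {R | ∃ (i : Fin (n + 1)) (P : Ideal (modelChart D x i)),
          P.IsPrime ∧ R = localizationSubring (modelChart D x i) P}

/-- `X(Z)`: the members of the projective model `X` dominated by some valuation ring
in `Z`. -/
def modelImage (X Z : Set (Subring F)) : Set (Subring F) :=
  {α ∈ X | ∃ V ∈ Z, Dominates V α}

/-- `A(Y)`: the intersection of a collection `Y` of subrings of `F`, as a subset of `F`. -/
def ringsInter (Y : Set (Subring F)) : Set F :=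
  ⋂ R ∈ Y, (R : Set F)

theorem Subring.isUnit_mk_iff {R : Subring F} {x : F} (h : x ∈ R) :
    IsUnit (⟨x, h⟩ : R) ↔ x ≠ 0 ∧ x⁻¹ ∈ R := by
  constructor
  · intro hu
    obtain ⟨y, hy⟩ := isUnit_iff_exists_inv.1 hu
    have hxy : x * (y : F) = 1 := congrArg Subtype.val hy
    refine ⟨left_ne_zero_of_mul_eq_one hxy, ?_⟩
    rw [inv_eq_of_mul_eq_one_right hxy]
    exact y.2
  · rintro ⟨h0, hi⟩
    exact isUnit_iff_exists_inv.2 ⟨⟨x⁻¹, hi⟩, Subtype.ext (mul_inv_cancel₀ h0)⟩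

theorem memMaxIdeal_iff {R : Subring F} {x : F} :
    MemMaxIdeal R x ↔ x ∈ R ∧ (x ≠ 0 → x⁻¹ ∉ R) := by
  constructor
  · rintro ⟨h, hu⟩
    rw [Subring.isUnit_mk_iff] at hu
    exact ⟨h, fun h0 hi => hu ⟨h0, hi⟩⟩
  · rintro ⟨h, hu⟩
    exact ⟨h, fun hx => hu ((Subring.isUnit_mk_iff h).1 hx).1 ((Subring.isUnit_mk_iff h).1 hx).2⟩

theorem dominates_iff {R S : Subring F} :
    Dominates R S ↔ S ≤ R ∧ ∀ x ∈ S, x ≠ 0 → x⁻¹ ∈ R → x⁻¹ ∈ S := by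
  constructor
  · rintro ⟨hle, h⟩
    refine ⟨hle, fun x hx h0 hi => ?_⟩
    by_contra hn
    exact (memMaxIdeal_iff.1 ((h x hx).1 (memMaxIdeal_iff.2 ⟨hx, fun _ => hn⟩))).2 h0 hi
  · rintro ⟨hle, h⟩
    refine ⟨hle, fun x hx => ?_⟩
    rw [memMaxIdeal_iff, memMaxIdeal_iff]
    exact ⟨fun hm => ⟨hle hx, fun h0 hi => hm.2 h0 (h x hx h0 hi)⟩,
      fun hm => ⟨hx, fun h0 hi => hm.2 h0 (hle hi)⟩⟩

theorem mem_localizationSubring_iff {A : Subring F} {P : Ideal A} (hP : P.IsPrime) {z : F} :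
    z ∈ localizationSubring A P ↔ ∃ a b : A, b ∉ P ∧ z = (a : F) * (b : F)⁻¹ := by
  have h1 : (1 : A) ∉ P := (Ideal.ne_top_iff_one P).1 hP.ne_top
  have hne : ∀ b : A, b ∉ P → (b : F) ≠ 0 := by
    intro b hb h0
    apply hb
    rw [Subtype.ext h0 (a2 := (0 : A))]
    exact P.zero_mem
  have hmul : ∀ b d : A, b ∉ P → d ∉ P → b * d ∉ P := fun b d hb hd h =>
    (hP.mem_or_mem h).elim hb hd
  refine ⟨fun hz => ?_, fun hz => Subring.subset_closure hz⟩
  unfold localizationSubring at hz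
  induction hz using Subring.closure_induction with
  | mem x hx => exact hx
  | zero => exact ⟨0, 1, h1, by simp⟩
  | one => exact ⟨1, 1, h1, by simp⟩
  | add x y _ _ hx hy =>
    obtain ⟨a, b, hb, rfl⟩ := hx
    obtain ⟨c, d, hd, rfl⟩ := hy
    refine ⟨a * d + c * b, b * d, hmul b d hb hd, ?_⟩
    have := hne b hb
    have := hne d hd
    push_cast
    field_simp
  | neg x _ hx =>
    obtain ⟨a, b, hb, rfl⟩ := hx
    exact ⟨-a, b, hb, by push_cast; ring⟩
  | mul x y _ _ hx hy =>
    obtain ⟨a, b, hb, rfl⟩ := hx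
    obtain ⟨c, d, hd, rfl⟩ := hy
    refine ⟨a * c, b * d, hmul b d hb hd, ?_⟩
    push_cast
    rw [mul_inv]
    ring

theorem le_localizationSubring {A : Subring F} {P : Ideal A} (hP : P.IsPrime) :
    A ≤ localizationSubring A P := fun x hx =>
  (mem_localizationSubring_iff hP).2
    ⟨⟨x, hx⟩, 1, (Ideal.ne_top_iff_one P).1 hP.ne_top, by simp⟩

/-- A valuation ring of `F`, bundled as a `ValuationSubring`. -/
def IsValSubring.toValuationSubring {V : Subring F} (hV : IsValSubring V) :
    ValuationSubring F where
  __ := V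
  mem_or_inv_mem' x := by
    by_cases h0 : x = 0
    · exact Or.inl (h0 ▸ V.zero_mem)
    · exact hV x h0

theorem IsValSubring.isLocalRing {V : Subring F} (hV : IsValSubring V) : IsLocalRing V :=
  inferInstanceAs (IsLocalRing hV.toValuationSubring)

theorem IsValSubring.exists_modelChart_le {D V : Subring F} (hV : IsValSubring V) (hD : D ≤ V)
    {n : ℕ} (x : Fin (n + 1) → F) : ∃ i, modelChart D x i ≤ V := by
  let W := hV.toValuationSubring
  obtain ⟨i, hi⟩ := Finite.exists_max fun i => W.valuation (x i)
  refine ⟨i, Subring.closure_le.2 ?_⟩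
  rintro y (hy | ⟨j, rfl⟩)
  · exact hD hy
  · have : x j * (x i)⁻¹ ∈ W := by
      rw [← W.valuation_le_one_iff, map_mul, map_inv₀]
      exact mul_inv_le_one_of_le₀ (hi j) zero_le
    exact this

theorem exists_dominates_localizationSubring {A V : Subring F} (hV : IsValSubring V)
    (hA : A ≤ V) : ∃ P : Ideal A, P.IsPrime ∧ Dominates V (localizationSubring A P) := by
  have := hV.isLocalRing
  let P : Ideal A := (IsLocalRing.maximalIdeal V).comap (Subring.inclusion hA)
  have hP : P.IsPrime := Ideal.IsPrime.comap _
  have hmem : ∀ b : A, b ∉ P ↔ (b : F) ≠ 0 ∧ (b : F)⁻¹ ∈ V := fun b => by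
    rw [← Subring.isUnit_mk_iff (hA b.2), Ideal.mem_comap, IsLocalRing.mem_maximalIdeal,
      mem_nonunits_iff, not_not]
    rfl
  refine ⟨P, hP, dominates_iff.2 ⟨fun z hz => ?_, fun z hz h0 hi => ?_⟩⟩
  · obtain ⟨a, b, hb, rfl⟩ := (mem_localizationSubring_iff hP).1 hz
    exact V.mul_mem (hA a.2) ((hmem b).1 hb).2
  · obtain ⟨a, b, hb, rfl⟩ := (mem_localizationSubring_iff hP).1 hz
    have hb0 := ((hmem b).1 hb).1
    have ha0 : (a : F) ≠ 0 := left_ne_zero_of_mul h0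
    refine (mem_localizationSubring_iff hP).2 ⟨b, a, (hmem a).2 ⟨ha0, ?_⟩, ?_⟩
    · have := V.mul_mem hi ((hmem b).1 hb).2
      rwa [mul_inv, inv_inv, mul_assoc, mul_inv_cancel₀ hb0, mul_one] at this
    · rw [mul_inv, inv_inv, mul_comm]

theorem sInf_modelImage_le {D : Subring F} {X Z : Set (Subring F)} (hZ : Z ⊆ zarSet D)
    (hX : IsProjModel D X) : sInf (modelImage X Z) ≤ sInf Z := by
  obtain ⟨n, x, -, rfl⟩ := hX
  refine le_sInf fun V hV => ?_
  obtain ⟨i, hi⟩ := (hZ hV).1.exists_modelChart_le (hZ hV).2 x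
  obtain ⟨P, hP, hdom⟩ := exists_dominates_localizationSubring (hZ hV).1 hi
  refine (sInf_le (a := localizationSubring (modelChart D x i) P) ?_).trans hdom.1
  exact ⟨⟨i, P, hP, rfl⟩, V, hV, hdom⟩

/-- In the model of `F/D` defined by `1, a` with `a ∈ A(Z)` nonzero, one has
`a ∈ A(X(Z))`. -/
theorem exists_isProjModel_mem_sInf_modelImage (D : Subring F) {Z : Set (Subring F)} {a : F}
    (ha : a ∈ sInf Z) (ha0 : a ≠ 0) :
    ∃ X, IsProjModel D X ∧ a ∈ sInf (modelImage X Z) := by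
  have hx : ∀ i, ![1, a] i ≠ 0 := by
    intro i
    fin_cases i
    · exact one_ne_zero
    · exact ha0
  refine ⟨_, ⟨1, ![1, a], hx, rfl⟩, Subring.mem_sInf.2 ?_⟩
  rintro α ⟨⟨i, P, hP, rfl⟩, V, hV, hdom⟩
  have hle := le_localizationSubring hP
  fin_cases i
  · exact hle (Subring.subset_closure (Or.inr ⟨1, by simp⟩))
  · have hinv := hle (Subring.subset_closure (Or.inr ⟨0, rfl⟩))
    have h := (dominates_iff.1 hdom).2 a⁻¹ (by simpa using hinv) (inv_ne_zero ha0)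
    rw [inv_inv] at h
    exact h (Subring.mem_sInf.1 ha V hV)

/-- For a nonempty subset `Z` of `Zar_F(D)`, the intersection `A(Z)` is a local ring
if and only if `A(X(Z))` is a local ring for every projective model `X` of `F/D`. -/
theorem statement8 (D : Subring F) (Z : Set (Subring F))
    (hZ : Z ⊆ zarSet D) (hne : Z.Nonempty) :
    IsLocalRing ↥(sInf Z) ↔
      ∀ X : Set (Subring F), IsProjModel D X → IsLocalRing ↥(sInf (modelImage X Z)) := by
  constructor
  · intro hloc X hX
    have hle := sInf_modelImage_le hZ hX
    have hunit : ∀ b : ↥(sInf (modelImage X Z)), IsUnit (Subring.inclusion hle b) → IsUnit b := by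
      rintro ⟨b, hb⟩ hu
      obtain ⟨h0, hi⟩ := (Subring.isUnit_mk_iff (hle hb)).1 hu
      refine (Subring.isUnit_mk_iff hb).2 ⟨h0, Subring.mem_sInf.2 ?_⟩
      rintro α hα
      obtain ⟨V, hV, hdom⟩ := hα.2
      exact (dominates_iff.1 hdom).2 b (Subring.mem_sInf.1 hb α hα) h0 (Subring.mem_sInf.1 hi V hV)
    refine IsLocalRing.of_isUnit_or_isUnit_of_isUnit_add fun b c hbc => ?_
    refine (IsLocalRing.isUnit_or_isUnit_of_isUnit_add
      (a := Subring.inclusion hle b) (b := Subring.inclusion hle c) ?_).imp (hunit b) (hunit c)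
    rw [← map_add]
    exact hbc.map _
  · intro h
    refine IsLocalRing.of_isUnit_or_isUnit_one_sub_self fun a => ?_
    by_cases ha0 : (a : F) = 0
    · right
      rw [show a = 0 from Subtype.ext ha0, sub_zero]
      exact isUnit_one
    · obtain ⟨X, hX, haX⟩ := exists_isProjModel_mem_sInf_modelImage D a.2 ha0
      have := h X hX
      have hle := sInf_modelImage_le hZ hX
      have hφ : Subring.inclusion hle ⟨a, haX⟩ = a := rfl
      rw [← hφ, ← map_one (Subring.inclusion hle), ← map_sub]
      exact (IsLocalRing.isUnit_or_isUnit_one_sub_self _).imp (fun hu => hu.map _)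
        (fun hu => hu.map _)
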